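/- Under generalized rejection sampling, the expected missingness rate satisfies the exact identity Σ_r p_R(r)·ℓ_r/d = 1 − Σ_{r ≠ 0} (π_r/Λ_r*)·(1 − ℓ_r/d). -/

import Mathlib

open Finset

noncomputable section

namespace AM

/-- A mask: `r i = true` means coordinate `i` is observed. -/
abbrev Mask (d : ℕ) := Fin d → Bool

/-- The all-missing mask. -/
def zeroMask (d : ℕ) : Mask d := fun _ => false

variable {d : ℕ} {α : Fin d → Type*} [∀ i, Fintype (α i)] [∀ i, DecidableEq (α i)]
  [∀ i, Nonempty (α i)]

/-- Restriction of a sample to the observed coordinates of a mask. -/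
def restr (r : Mask d) (x : ∀ i, α i) : ∀ i : {i : Fin d // r i = true}, α i.1 :=
  fun i => x i.1

/-- Observed marginal of a pmf under mask `r`. -/
def obsMarg (p : (∀ i, α i) → ℝ) (r : Mask d)
    (xo : ∀ i : {i : Fin d // r i = true}, α i.1) : ℝ :=
  ∑ x : ∀ i, α i, if restr r x = xo then p x else 0

/-- Marginal pmf of the mask under missingness mechanism `q`. -/
def maskMarg (p : (∀ i, α i) → ℝ) (q : Mask d → (∀ i, α i) → ℝ) (r : Mask d) : ℝ :=
  ∑ x : ∀ i, α i, p x * q r x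

/-- Conditional pmf of the observed part given the mask: `P(X_o = x_o | R = r)`. -/
def condObs (p : (∀ i, α i) → ℝ) (q : Mask d → (∀ i, α i) → ℝ) (r : Mask d)
    (xo : ∀ i : {i : Fin d // r i = true}, α i.1) : ℝ :=
  (∑ x : ∀ i, α i, if restr r x = xo then p x * q r x else 0) / maskMarg p q r

/-- The number of missing coordinates of a mask. -/
def missCount {d : ℕ} (r : Mask d) : ℕ := (univ.filter fun i => r i = false).card

/-- Total mass of the nonzero masks. -/
def totMass (p : (∀ i, α i) → ℝ) (q : Mask d → (∀ i, α i) → ℝ) : ℝ :=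
  ∑ r' ∈ univ.filter (fun r' : Mask d => r' ≠ zeroMask d), maskMarg p q r'

/-- The modeler's objective. -/
def Jobj (p : (∀ i, α i) → ℝ) (q : Mask d → (∀ i, α i) → ℝ) (θ : (∀ i, α i) → ℝ) : ℝ :=
  ∑ r : Mask d,
    if r ≠ zeroMask d ∧ 0 < maskMarg p q r then
      maskMarg p q r / totMass p q *
        ∑ xo : ∀ i : {i : Fin d // r i = true}, α i.1,
          condObs p q r xo * Real.log (obsMarg θ r xo)
    else 0

/-- Likelihood ratio of adversarial to true observed marginals. -/
def Lam (p pα : (∀ i, α i) → ℝ) (r : Mask d)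
    (xo : ∀ i : {i : Fin d // r i = true}, α i.1) : ℝ :=
  obsMarg pα r xo / obsMarg p r xo

/-- Maximum of the likelihood ratio over observed parts. -/
def LamMax (p pα : (∀ i, α i) → ℝ) (r : Mask d) : ℝ :=
  Finset.univ.sup' Finset.univ_nonempty (Lam p pα r)

/-- Generalized rejection sampling missingness mechanism with weights `w`. -/
def grs (p pα : (∀ i, α i) → ℝ) (w : Mask d → ℝ) (r : Mask d) (x : ∀ i, α i) : ℝ :=
  if r = zeroMask d then
    1 - ∑ r' ∈ univ.filter (fun r' : Mask d => r' ≠ zeroMask d),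
          w r' * Lam p pα r' (restr r' x) / LamMax p pα r'
  else w r * Lam p pα r (restr r x) / LamMax p pα r

/-- Restriction of a sample to the coordinates in a finset. -/
def restrS (S : Finset (Fin d)) (x : ∀ i, α i) : ∀ i : {i : Fin d // i ∈ S}, α i.1 :=
  fun i => x i.1

/-- Marginal pmf of the coordinates in `S`. -/
def margS (p : (∀ i, α i) → ℝ) (S : Finset (Fin d))
    (xs : ∀ i : {i : Fin d // i ∈ S}, α i.1) : ℝ :=
  ∑ x : ∀ i, α i, if restrS S x = xs then p x else 0

/-- Ratio of adversarial to true marginals on `V`. -/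
def LamV (p pα : (∀ i, α i) → ℝ) (V : Finset (Fin d))
    (xv : ∀ i : {i : Fin d // i ∈ V}, α i.1) : ℝ :=
  margS pα V xv / margS p V xv

/-- Maximum of the ratio over configurations of `V`. -/
def LamVMax (p pα : (∀ i, α i) → ℝ) (V : Finset (Fin d)) : ℝ :=
  Finset.univ.sup' Finset.univ_nonempty (LamV p pα V)

/-- Localized rejection sampling missingness mechanism on `V`. -/
def lrs (p pα : (∀ i, α i) → ℝ) (V : Finset (Fin d)) (r : Mask d) (x : ∀ i, α i) : ℝ :=
  if ∀ i ∉ V, r i = true then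
    if ∃ i ∈ V, r i = true then
      1 / ((2 : ℝ) ^ V.card - 1) * (LamV p pα V (restrS V x) / LamVMax p pα V)
    else 1 - LamV p pα V (restrS V x) / LamVMax p pα V
  else 0

/-- Conditional pmf of the complement coordinates given the `V` coordinates. -/
def condComp (p : (∀ i, α i) → ℝ) (V : Finset (Fin d))
    (xv : ∀ i : {i : Fin d // i ∈ V}, α i.1)
    (xc : ∀ i : {i : Fin d // i ∈ Vᶜ}, α i.1) : ℝ :=
  (∑ x : ∀ i, α i, if restrS V x = xv ∧ restrS Vᶜ x = xc then p x else 0) / margS p V xv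

/-- Conditional pmf of the `V` coordinates given the mask: `P(X_V = x_V | R = r)`. -/
def condV (p : (∀ i, α i) → ℝ) (q : Mask d → (∀ i, α i) → ℝ) (V : Finset (Fin d)) (r : Mask d)
    (xv : ∀ i : {i : Fin d // i ∈ V}, α i.1) : ℝ :=
  (∑ x : ∀ i, α i, if restrS V x = xv then p x * q r x else 0) / maskMarg p q r

/-- Conditional pmf of coordinate `j` given that the coordinates in `S` equal `z`. -/
def condAt (p : (∀ i, α i) → ℝ) (S : Finset (Fin d)) (j : Fin d)
    (z : ∀ i : {i : Fin d // i ∈ S}, α i.1) (a : α j) : ℝ :=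
  (∑ x : ∀ i, α i, if restrS S x = z ∧ x j = a then p x else 0) / margS p S z

/-- `p` factorizes according to the parent structure `pa`. -/
def Factorizes (p : (∀ i, α i) → ℝ) (pa : Fin d → Finset (Fin d)) : Prop :=
  ∀ x, p x = ∏ j, condAt p (pa j) j (restrS (pa j) x) (x j)

/-- KL divergence between two pmfs on a finite type. -/
def KL {β : Type*} [Fintype β] (p q : β → ℝ) : ℝ :=
  ∑ b, p b * Real.log (p b / q b)


theorem restr_surjective {d : ℕ} {α : Fin d → Type*} [∀ i, Nonempty (α i)] (r : Mask d) :
    Function.Surjective (restr (α := α) r) := by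
  intro xo
  refine ⟨fun i => if h : r i = true then xo ⟨i, h⟩ else Classical.arbitrary (α i), ?_⟩
  funext i
  simp [restr, i.2]

theorem obsMarg_pos {p : (∀ i, α i) → ℝ} (hp : ∀ x, 0 < p x) (r : Mask d)
    (xo : ∀ i : {i : Fin d // r i = true}, α i.1) : 0 < obsMarg p r xo := by
  obtain ⟨x, hx⟩ := restr_surjective r xo
  refine Finset.sum_pos' (fun y _ => ?_) ⟨x, mem_univ x, ?_⟩
  · split_ifs
    · exact (hp y).le
    · exact le_rfl
  · simpa [hx] using hp x

/-- Law of the unconscious statistician for the observed part. -/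
theorem sum_obsMarg_mul {d : ℕ} {α : Fin d → Type*} [∀ i, Fintype (α i)]
    [∀ i, DecidableEq (α i)] (p : (∀ i, α i) → ℝ) (r : Mask d)
    (g : (∀ i : {i : Fin d // r i = true}, α i.1) → ℝ) :
    ∑ xo, obsMarg p r xo * g xo = ∑ x, p x * g (restr r x) := by
  simp only [obsMarg, Finset.sum_mul, ite_mul, zero_mul]
  rw [Finset.sum_comm]
  simp

/-- The likelihood ratio of the observed parts has mean equal to the adversarial total mass. -/
theorem sum_mul_Lam {p : (∀ i, α i) → ℝ} (hp : ∀ x, 0 < p x) (pα : (∀ i, α i) → ℝ)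
    (r : Mask d) : ∑ x, p x * Lam p pα r (restr r x) = ∑ x, pα x := by
  rw [← sum_obsMarg_mul p r (Lam p pα r)]
  calc ∑ xo, obsMarg p r xo * Lam p pα r xo = ∑ xo, obsMarg pα r xo * 1 :=
        Finset.sum_congr rfl fun xo _ => by
          rw [Lam, mul_div_cancel₀ _ (obsMarg_pos hp r xo).ne', mul_one]
    _ = ∑ x, pα x := by simpa using sum_obsMarg_mul pα r fun _ => 1

theorem sum_mul_weighted_Lam {p pα : (∀ i, α i) → ℝ} (hp : ∀ x, 0 < p x)
    (hpα : ∑ x, pα x = 1) (w : Mask d → ℝ) (r : Mask d) :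
    ∑ x, p x * (w r * Lam p pα r (restr r x) / LamMax p pα r) = w r / LamMax p pα r := by
  calc ∑ x, p x * (w r * Lam p pα r (restr r x) / LamMax p pα r)
      = ∑ x, w r / LamMax p pα r * (p x * Lam p pα r (restr r x)) :=
        Finset.sum_congr rfl fun x _ => by ring
    _ = w r / LamMax p pα r := by rw [← Finset.mul_sum, sum_mul_Lam hp, hpα, mul_one]

theorem maskMarg_grs_of_ne {p pα : (∀ i, α i) → ℝ} (hp : ∀ x, 0 < p x)
    (hpα : ∑ x, pα x = 1) (w : Mask d → ℝ) {r : Mask d} (hr : r ≠ zeroMask d) :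
    maskMarg p (grs p pα w) r = w r / LamMax p pα r := by
  simp only [maskMarg, grs, if_neg hr]
  exact sum_mul_weighted_Lam hp hpα w r

theorem maskMarg_grs_zeroMask {p pα : (∀ i, α i) → ℝ} (hp : ∀ x, 0 < p x)
    (hp_sum : ∑ x, p x = 1) (hpα : ∑ x, pα x = 1) (w : Mask d → ℝ) :
    maskMarg p (grs p pα w) (zeroMask d) =
      1 - ∑ r ∈ univ.filter (fun r : Mask d => r ≠ zeroMask d), w r / LamMax p pα r := by
  simp only [maskMarg, grs, if_true, mul_sub, mul_one, Finset.sum_sub_distrib, hp_sum,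
    Finset.mul_sum]
  rw [Finset.sum_comm]
  simp only [sum_mul_weighted_Lam hp hpα w]

theorem missCount_zeroMask (d : ℕ) : missCount (zeroMask d) = d := by
  simp [missCount, zeroMask]

/-- under generalized rejection sampling, the expected missingness rate satisfies
`Σ_r p_R(r)·ℓ_r/d = 1 − Σ_{r ≠ 0} (π_r/Λ_r*)·(1 − ℓ_r/d)`. -/
theorem stmt4
    {d : ℕ} (hd : 1 ≤ d) {α : Fin d → Type*} [∀ i, Fintype (α i)] [∀ i, DecidableEq (α i)]
    [∀ i, Nonempty (α i)]
    (p pα : (∀ i, α i) → ℝ)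
    (hp_pos : ∀ x, 0 < p x) (hp_sum : ∑ x, p x = 1)
    (hpα_nonneg : ∀ x, 0 ≤ pα x) (hpα_sum : ∑ x, pα x = 1)
    (w : Mask d → ℝ)
    (hw : ∀ r : Mask d, r ≠ zeroMask d → 0 ≤ w r ∧ w r ≤ 1)
    (hvalid : ∀ x : ∀ i, α i,
      ∑ r ∈ univ.filter (fun r : Mask d => r ≠ zeroMask d),
          w r * Lam p pα r (restr r x) / LamMax p pα r ≤ 1) :
    ∑ r : Mask d, maskMarg p (grs p pα w) r * ((missCount r : ℝ) / d)
      = 1 - ∑ r ∈ univ.filter (fun r : Mask d => r ≠ zeroMask d),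
          w r / LamMax p pα r * (1 - (missCount r : ℝ) / d) := by
  have hd' : (d : ℝ) ≠ 0 := Nat.cast_ne_zero.mpr (by omega)
  have hne : ∑ r ∈ univ.filter (fun r : Mask d => r ≠ zeroMask d),
        maskMarg p (grs p pα w) r * ((missCount r : ℝ) / d)
      = ∑ r ∈ univ.filter (fun r : Mask d => r ≠ zeroMask d),
        w r / LamMax p pα r * ((missCount r : ℝ) / d) :=
    Finset.sum_congr rfl fun r hr => by
      rw [maskMarg_grs_of_ne hp_pos hpα_sum w (Finset.mem_filter.mp hr).2]
  rw [← Finset.add_sum_erase _ _ (mem_univ (zeroMask d)), ← Finset.filter_ne' univ (zeroMask d),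
    hne, maskMarg_grs_zeroMask hp_pos hp_sum hpα_sum, missCount_zeroMask, div_self hd', mul_one]
  simp only [mul_sub, mul_one, Finset.sum_sub_distrib]
  ring

end AM
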